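/- Let α and β be probability measures on ℝ with finite second moments and suppose α is absolutely continuous with respect to Lebesgue measure. Then the map T := F_β^{-1} ∘ F_α satisfies T_♯α = β, and T minimizes ∫ |x − T'(x)|² dα(x) over all measurable maps T' : ℝ → ℝ with T'_♯α = β; moreover its minimal value equals the Kantorovich cost L(α, β). -/

import Mathlib

open MeasureTheory ProbabilityTheory

/-- The quantile function `F_μ⁻¹ (u) = inf {x | F_μ x ≥ u}` of a measure on `ℝ`. -/
noncomputable def quantile (μ : Measure ℝ) (u : ℝ) : ℝ :=
  sInf {x : ℝ | u ≤ cdf μ x}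

/-- The Kantorovich cost `L(α,β)` for the quadratic cost on `ℝ`: the infimum of
`∫ |x - y|² dπ` over all couplings `π` of `α` and `β`. -/
noncomputable def kantorovich (α β : Measure ℝ) : ℝ :=
  sInf {c : ℝ | ∃ π : Measure (ℝ × ℝ), IsProbabilityMeasure π ∧
    π.map Prod.fst = α ∧ π.map Prod.snd = β ∧ c = ∫ p, |p.1 - p.2| ^ 2 ∂π}

open Set Filter Topology

/-- The squared length of the positive part, integrated, as an integral of probabilities. -/
lemma lintegral_ofReal_sub_sq {Ω : Type*} [MeasurableSpace Ω] (P : Measure Ω) [SFinite P]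
    {X Y : Ω → ℝ} (hX : Measurable X) (hY : Measurable Y) :
    ∫⁻ ω, ENNReal.ofReal (Y ω - X ω) ^ 2 ∂P =
      ∫⁻ q : ℝ × ℝ, P {ω | X ω ≤ min q.1 q.2 ∧ max q.1 q.2 < Y ω} := by
  have hS : MeasurableSet {z : Ω × (ℝ × ℝ) |
      X z.1 ≤ min z.2.1 z.2.2 ∧ max z.2.1 z.2.2 < Y z.1} := by
    rw [ofPred_and]
    exact (measurableSet_le (by fun_prop) (by fun_prop)).inter
      (measurableSet_lt (by fun_prop) (by fun_prop))
  have h := Measure.prod_apply (μ := P) (ν := (volume : Measure (ℝ × ℝ))) hS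
  rw [Measure.prod_apply_symm hS] at h
  refine Eq.trans (lintegral_congr fun ω => ?_) h.symm
  have : Prod.mk ω ⁻¹' {z : Ω × (ℝ × ℝ) |
      X z.1 ≤ min z.2.1 z.2.2 ∧ max z.2.1 z.2.2 < Y z.1} =
      Ico (X ω) (Y ω) ×ˢ Ico (X ω) (Y ω) := by
    ext ⟨s, t⟩
    simp only [mem_preimage, mem_ofPred_eq, le_min_iff, max_lt_iff, mem_prod, mem_Ico]
    tauto
  rw [this, Measure.volume_eq_prod, Measure.prod_prod, Real.volume_Ico, sq]

/-- The expected squared distance of two random variables in terms of their joint law. -/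
lemma lintegral_ofReal_abs_sub_sq {Ω : Type*} [MeasurableSpace Ω] (P : Measure Ω) [SFinite P]
    {X Y : Ω → ℝ} (hX : Measurable X) (hY : Measurable Y) :
    ∫⁻ ω, ENNReal.ofReal (|X ω - Y ω| ^ 2) ∂P =
      (∫⁻ q : ℝ × ℝ, P {ω | X ω ≤ min q.1 q.2 ∧ max q.1 q.2 < Y ω}) +
      ∫⁻ q : ℝ × ℝ, P {ω | Y ω ≤ min q.1 q.2 ∧ max q.1 q.2 < X ω} := by
  rw [← lintegral_ofReal_sub_sq P hX hY, ← lintegral_ofReal_sub_sq P hY hX,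
    ← lintegral_add_left (by fun_prop)]
  refine lintegral_congr fun ω => ?_
  rw [ENNReal.ofReal_pow (abs_nonneg _)]
  rcases le_total (X ω) (Y ω) with h | h
  · rw [abs_of_nonpos (sub_nonpos.2 h), ENNReal.ofReal_of_nonpos (sub_nonpos.2 h)]
    simp
  · rw [abs_of_nonneg (sub_nonneg.2 h), ENNReal.ofReal_of_nonpos (sub_nonpos.2 h)]
    simp

/-- A comonotone pair minimizes the probability of `{X ≤ s, t < Y}` among pairs with the same
marginals. -/
lemma measure_le_lt_le_of_comonotone {Ω Ω' : Type*} [MeasurableSpace Ω] [MeasurableSpace Ω']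
    {P : Measure Ω} {Q : Measure Ω'} [IsFiniteMeasure P]
    {X Y : Ω → ℝ} {X' Y' : Ω' → ℝ} {s t : ℝ} (hY : Measurable Y)
    (hXX' : P {ω | X ω ≤ s} = Q {ω | X' ω ≤ s}) (hYY' : P {ω | Y ω ≤ t} = Q {ω | Y' ω ≤ t})
    (hco : P {ω | X ω ≤ s ∧ t < Y ω} = 0 ∨ P {ω | Y ω ≤ t ∧ s < X ω} = 0) :
    P {ω | X ω ≤ s ∧ t < Y ω} ≤ Q {ω | X' ω ≤ s ∧ t < Y' ω} := by
  rcases hco with h | h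
  · simp [h]
  have hsplit : P {ω | X ω ≤ s} = P {ω | X ω ≤ s ∧ Y ω ≤ t} + P {ω | X ω ≤ s ∧ t < Y ω} := by
    rw [← measure_inter_add_sdiff {ω | X ω ≤ s} (hY measurableSet_Iic : MeasurableSet (Y ⁻¹' Iic t))]
    congr 2
    ext ω
    simp
  have hP : P {ω | Y ω ≤ t} ≤ P {ω | X ω ≤ s ∧ Y ω ≤ t} := by
    calc P {ω | Y ω ≤ t} ≤ P ({ω | X ω ≤ s ∧ Y ω ≤ t} ∪ {ω | Y ω ≤ t ∧ s < X ω}) := by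
          refine measure_mono fun ω hω => ?_
          rcases le_or_gt (X ω) s with hx | hx
          · exact Or.inl ⟨hx, hω⟩
          · exact Or.inr ⟨hω, hx⟩
      _ ≤ _ := (measure_union_le _ _).trans (by rw [h, add_zero])
  have hQ : Q {ω | X' ω ≤ s} ≤ Q {ω | Y' ω ≤ t} + Q {ω | X' ω ≤ s ∧ t < Y' ω} := by
    refine (measure_mono fun ω hω => ?_).trans (measure_union_le _ _)
    rcases le_or_gt (Y' ω) t with hy | hy
    · exact Or.inl hy
    · exact Or.inr ⟨hω, hy⟩
  rw [← hXX', ← hYY', hsplit] at hQ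
  exact (ENNReal.add_le_add_iff_left (measure_ne_top P _)).1 (hQ.trans (by gcongr))

/-- A comonotone pair minimizes the expected squared distance among pairs with the same
marginals. -/
lemma lintegral_abs_sub_sq_le_of_comonotone {Ω Ω' : Type*} [MeasurableSpace Ω]
    [MeasurableSpace Ω'] {P : Measure Ω} {Q : Measure Ω'} [IsFiniteMeasure P] [SFinite Q]
    {X Y : Ω → ℝ} {X' Y' : Ω' → ℝ} (hX : Measurable X) (hY : Measurable Y)
    (hX' : Measurable X') (hY' : Measurable Y')
    (hXX' : P.map X = Q.map X') (hYY' : P.map Y = Q.map Y')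
    (hco : ∀ s t, P {ω | X ω ≤ s ∧ t < Y ω} = 0 ∨ P {ω | Y ω ≤ t ∧ s < X ω} = 0) :
    ∫⁻ ω, ENNReal.ofReal (|X ω - Y ω| ^ 2) ∂P ≤
      ∫⁻ ω, ENNReal.ofReal (|X' ω - Y' ω| ^ 2) ∂Q := by
  have hx (s : ℝ) : P {ω | X ω ≤ s} = Q {ω | X' ω ≤ s} := by
    have := congrArg (fun μ => μ (Iic s)) hXX'
    simpa [Measure.map_apply, hX, hX', measurableSet_Iic, preimage, mem_Iic] using this
  have hy (s : ℝ) : P {ω | Y ω ≤ s} = Q {ω | Y' ω ≤ s} := by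
    have := congrArg (fun μ => μ (Iic s)) hYY'
    simpa [Measure.map_apply, hY, hY', measurableSet_Iic, preimage, mem_Iic] using this
  rw [lintegral_ofReal_abs_sub_sq P hX hY, lintegral_ofReal_abs_sub_sq Q hX' hY']
  refine add_le_add (lintegral_mono fun q => ?_) (lintegral_mono fun q => ?_)
  · exact measure_le_lt_le_of_comonotone hY (hx _) (hy _) (hco _ _)
  · exact measure_le_lt_le_of_comonotone hX (hy _) (hx _) (hco _ _).symm

lemma quantile_le_iff (μ : Measure ℝ) {u : ℝ} (hu : u ∈ Ioo (0 : ℝ) 1) (t : ℝ) :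
    quantile μ u ≤ t ↔ u ≤ cdf μ t := by
  have hbdd : BddBelow {x : ℝ | u ≤ cdf μ x} := by
    obtain ⟨a, ha⟩ := ((tendsto_cdf_atBot μ).eventually (gt_mem_nhds hu.1)).exists
    exact ⟨a, fun x hx => le_of_not_gt fun hxa =>
      absurd (hx.trans (monotone_cdf μ hxa.le)) (not_le.2 ha)⟩
  have hne : {x : ℝ | u ≤ cdf μ x}.Nonempty := by
    obtain ⟨a, ha⟩ := ((tendsto_cdf_atTop μ).eventually (lt_mem_nhds hu.2)).exists
    exact ⟨a, ha.le⟩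
  refine ⟨fun h => ?_, fun h => csInf_le hbdd h⟩
  have hright : Tendsto (cdf μ) (𝓝[>] t) (𝓝 (cdf μ t)) :=
    ((cdf μ).right_continuous t).tendsto.mono_left (nhdsWithin_mono _ Ioi_subset_Ici_self)
  refine ge_of_tendsto hright ?_
  filter_upwards [self_mem_nhdsWithin] with y hy
  obtain ⟨x, hx, hxy⟩ := exists_lt_of_csInf_lt hne (lt_of_le_of_lt h hy)
  exact hx.trans (monotone_cdf μ hxy.le)

lemma measurable_indicator_quantile (μ : Measure ℝ) :
    Measurable ((Ioo (0 : ℝ) 1).indicator (quantile μ)) := by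
  refine measurable_of_Iic fun t => ?_
  have : (Ioo (0 : ℝ) 1).indicator (quantile μ) ⁻¹' Iic t =
      (Ioo 0 1 ∩ Iic (cdf μ t)) ∪ ((Ioo 0 1)ᶜ ∩ {_u | 0 ≤ t}) := by
    ext u
    by_cases hu : u ∈ Ioo (0 : ℝ) 1
    · simp [-mem_Ioo, hu, quantile_le_iff μ hu]
    · simp [-mem_Ioo, hu]
  rw [this]
  exact (measurableSet_Ioo.inter measurableSet_Iic).union
    (measurableSet_Ioo.compl.inter (MeasurableSet.const _))

lemma continuous_cdf (μ : Measure ℝ) [IsProbabilityMeasure μ] [NullSingletonClass μ] :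
    Continuous (cdf μ) := by
  refine continuous_iff_continuousAt.2 fun x => ?_
  rw [(monotone_cdf μ).continuousAt_iff_leftLim_eq_rightLim, (cdf μ).rightLim_eq]
  have h := (cdf μ).measure_singleton x
  rw [measure_cdf, measure_singleton, eq_comm, ENNReal.ofReal_eq_zero] at h
  exact le_antisymm ((monotone_cdf μ).leftLim_le le_rfl) (by linarith)

lemma exists_cdf_eq (μ : Measure ℝ) [IsProbabilityMeasure μ] [NullSingletonClass μ] {c : ℝ}
    (hc : c ∈ Ioo (0 : ℝ) 1) : ∃ x, cdf μ x = c :=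
  mem_range_of_exists_le_of_exists_ge (continuous_cdf μ)
    (((tendsto_cdf_atBot μ).eventually (gt_mem_nhds hc.1)).exists.imp fun _ h => h.le)
    (((tendsto_cdf_atTop μ).eventually (lt_mem_nhds hc.2)).exists.imp fun _ h => h.le)

/-- The probability integral transform: `F_μ` is uniformly distributed under `μ`. -/
lemma measureReal_cdf_le (μ : Measure ℝ) [IsProbabilityMeasure μ] [NullSingletonClass μ] {c : ℝ}
    (hc : c ∈ Icc (0 : ℝ) 1) : μ.real {x | cdf μ x ≤ c} = c := by
  rcases hc.2.eq_or_lt with rfl | hc1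
  · simp [cdf_le_one]
  refine le_antisymm (le_of_forall_gt_imp_ge_of_dense fun d hd => ?_) ?_
  · rcases le_or_gt 1 d with h1 | h1
    · exact measureReal_le_one.trans h1
    obtain ⟨x, hx⟩ := exists_cdf_eq μ (c := d) ⟨hc.1.trans_lt hd, h1⟩
    rw [← hx, cdf_eq_real]
    refine measureReal_mono fun y hy => mem_Iic.2 (le_of_not_gt fun hxy => ?_)
    have h := (monotone_cdf μ hxy.le).trans hy
    linarith
  · rcases hc.1.eq_or_lt with rfl | hc0
    · exact measureReal_nonneg
    obtain ⟨x, hx⟩ := exists_cdf_eq μ (c := c) ⟨hc0, hc1⟩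
    conv_lhs => rw [← hx, cdf_eq_real]
    exact measureReal_mono fun y hy => (monotone_cdf μ hy).trans hx.le

lemma ae_cdf_mem_Ioo (μ : Measure ℝ) [IsProbabilityMeasure μ] [NullSingletonClass μ] :
    ∀ᵐ x ∂μ, cdf μ x ∈ Ioo (0 : ℝ) 1 := by
  have h0 : ∀ᵐ x ∂μ, 0 < cdf μ x := by
    have h := measureReal_cdf_le μ (c := 0) (by simp)
    rw [measureReal_eq_zero_iff] at h
    simpa [ae_iff] using h
  have h1 : ∀ᵐ x ∂μ, cdf μ x < 1 := by
    have h : μ.real {x | 1 ≤ cdf μ x} = 0 := by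
      refine le_antisymm (le_of_forall_gt_imp_ge_of_dense fun d hd => ?_) measureReal_nonneg
      rcases le_or_gt 1 d with hd1 | hd1
      · exact measureReal_le_one.trans hd1
      have hm : MeasurableSet {x | cdf μ x ≤ 1 - d} :=
        measurableSet_le (monotone_cdf μ).measurable measurable_const
      have h := probReal_compl_eq_one_sub (μ := μ) hm
      rw [measureReal_cdf_le μ ⟨by linarith, by linarith⟩] at h
      calc μ.real {x | 1 ≤ cdf μ x} ≤ μ.real {x | cdf μ x ≤ 1 - d}ᶜ := by
            refine measureReal_mono fun y hy => ?_
            simp only [mem_compl_iff, mem_ofPred_eq, not_le] at hy ⊢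
            linarith
        _ = d := by rw [h]; ring
    rw [measureReal_eq_zero_iff] at h
    simpa [ae_iff] using h
  filter_upwards [h0, h1] with x hx0 hx1 using ⟨hx0, hx1⟩

/-- A measurable version of the monotone rearrangement `F_β⁻¹ ∘ F_α`. -/
noncomputable def monotoneTransport (α β : Measure ℝ) (x : ℝ) : ℝ :=
  (Ioo (0 : ℝ) 1).indicator (quantile β) (cdf α x)

lemma measurable_monotoneTransport (α β : Measure ℝ) : Measurable (monotoneTransport α β) :=
  (measurable_indicator_quantile β).comp (monotone_cdf α).measurable

lemma quantile_cdf_ae_eq_monotoneTransport (α β : Measure ℝ) [IsProbabilityMeasure α]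
    [NullSingletonClass α] : (fun x => quantile β (cdf α x)) =ᵐ[α] monotoneTransport α β := by
  filter_upwards [ae_cdf_mem_Ioo α] with x hx
  rw [monotoneTransport, indicator_of_mem hx]

lemma ae_monotoneTransport_le_iff (α β : Measure ℝ) [IsProbabilityMeasure α] [NullSingletonClass α] :
    ∀ᵐ x ∂α, ∀ t, monotoneTransport α β x ≤ t ↔ cdf α x ≤ cdf β t := by
  filter_upwards [ae_cdf_mem_Ioo α] with x hx t
  rw [monotoneTransport, indicator_of_mem hx, quantile_le_iff β hx]

lemma map_monotoneTransport (α β : Measure ℝ) [IsProbabilityMeasure α] [IsProbabilityMeasure β]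
    [NullSingletonClass α] : α.map (monotoneTransport α β) = β := by
  have hm := measurable_monotoneTransport α β
  have := Measure.isProbabilityMeasure_map (μ := α) hm.aemeasurable
  refine Measure.eq_of_cdf _ _ (StieltjesFunction.ext fun t => ?_)
  rw [cdf_eq_real, map_measureReal_apply hm measurableSet_Iic,
    ← measureReal_cdf_le α ⟨cdf_nonneg β t, cdf_le_one β t⟩]
  refine measureReal_congr ?_
  filter_upwards [ae_monotoneTransport_le_iff α β] with x hx
  exact propext (hx t)

lemma comonotone_monotoneTransport (α β : Measure ℝ) [IsProbabilityMeasure α] [NullSingletonClass α]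
    (s t : ℝ) : α {x | x ≤ s ∧ t < monotoneTransport α β x} = 0 ∨
      α {x | monotoneTransport α β x ≤ t ∧ s < x} = 0 := by
  rcases le_or_gt (cdf α s) (cdf β t) with h | h
  · left
    refine measure_mono_null ?_ (ae_iff.1 (ae_monotoneTransport_le_iff α β))
    rintro x ⟨hxs, hxt⟩ hx
    exact hxt.not_ge ((hx t).2 ((monotone_cdf α hxs).trans h))
  · right
    refine measure_mono_null ?_ (ae_iff.1 (ae_monotoneTransport_le_iff α β))
    rintro x ⟨hxt, hxs⟩ hx
    exact (((hx t).1 hxt).trans_lt h).not_ge (monotone_cdf α hxs.le)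

/-- The monotone rearrangement costs no more than any coupling of `α` and `β`. -/
lemma integral_monotoneTransport_le {α β : Measure ℝ} [IsProbabilityMeasure α]
    [IsProbabilityMeasure β] [NullSingletonClass α]
    (hα2 : Integrable (fun x => |x| ^ 2) α) (hβ2 : Integrable (fun x => |x| ^ 2) β)
    {Ω : Type*} [MeasurableSpace Ω] {Q : Measure Ω} [SFinite Q] {X Y : Ω → ℝ}
    (hX : Measurable X) (hY : Measurable Y) (hXα : Q.map X = α) (hYβ : Q.map Y = β) :
    ∫ x, |x - monotoneTransport α β x| ^ 2 ∂α ≤ ∫ ω, |X ω - Y ω| ^ 2 ∂Q := by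
  have hm := measurable_monotoneTransport α β
  have hX2 : MemLp X 2 Q := by
    rw [memLp_two_iff_integrable_sq hX.aestronglyMeasurable]
    rw [← hXα] at hα2
    simpa [Function.comp_def] using hα2.comp_measurable hX
  have hY2 : MemLp Y 2 Q := by
    rw [memLp_two_iff_integrable_sq hY.aestronglyMeasurable]
    rw [← hYβ] at hβ2
    simpa [Function.comp_def] using hβ2.comp_measurable hY
  have hint : Integrable (fun ω => |X ω - Y ω| ^ 2) Q := by
    simpa using (hX2.sub hY2).integrable_sq
  rw [integral_eq_lintegral_of_nonneg_ae (ae_of_all _ fun _ => by positivity)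
      (by fun_prop),
    integral_eq_lintegral_of_nonneg_ae (ae_of_all _ fun _ => by positivity)
      hint.aestronglyMeasurable]
  refine ENNReal.toReal_mono hint.lintegral_lt_top.ne ?_
  exact lintegral_abs_sub_sq_le_of_comonotone measurable_id hm hX hY
    (Measure.map_id.trans hXα.symm) (by rw [map_monotoneTransport, hYβ])
    (comonotone_monotoneTransport α β)

/-- For probability measures `α, β` on `ℝ` with finite second moments and
`α` absolutely continuous w.r.t. Lebesgue, the map `T = F_β⁻¹ ∘ F_α` pushes `α` forward to
`β`, minimizes the quadratic transport cost among all such maps, and its cost equals the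
Kantorovich cost `L(α, β)`. -/
theorem univariate_optimal_transport_map
    (α β : Measure ℝ) [IsProbabilityMeasure α] [IsProbabilityMeasure β]
    (hα2 : Integrable (fun x => |x| ^ 2) α) (hβ2 : Integrable (fun x => |x| ^ 2) β)
    (hαac : α ≪ volume)
    (T : ℝ → ℝ) (hT : T = fun x => quantile β (cdf α x)) :
    α.map T = β ∧
    (∀ T' : ℝ → ℝ, Measurable T' → α.map T' = β →
      ∫ x, |x - T x| ^ 2 ∂α ≤ ∫ x, |x - T' x| ^ 2 ∂α) ∧
    ∫ x, |x - T x| ^ 2 ∂α = kantorovich α β := by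
  have : NullSingletonClass α := ⟨fun x => hαac (measure_singleton x)⟩
  have hm := measurable_monotoneTransport α β
  have hTae : T =ᵐ[α] monotoneTransport α β := hT ▸ quantile_cdf_ae_eq_monotoneTransport α β
  have hcost : ∫ x, |x - T x| ^ 2 ∂α = ∫ x, |x - monotoneTransport α β x| ^ 2 ∂α := by
    refine integral_congr_ae ?_
    filter_upwards [hTae] with x hx
    rw [hx]
  rw [hcost]
  refine ⟨(Measure.map_congr hTae).trans (map_monotoneTransport α β), fun T' hT' hmap => ?_, ?_⟩
  · exact integral_monotoneTransport_le hα2 hβ2 measurable_id hT' Measure.map_id hmap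
  have hmem : ∫ x, |x - monotoneTransport α β x| ^ 2 ∂α ∈
      {c : ℝ | ∃ π : Measure (ℝ × ℝ), IsProbabilityMeasure π ∧
        π.map Prod.fst = α ∧ π.map Prod.snd = β ∧ c = ∫ p, |p.1 - p.2| ^ 2 ∂π} := by
    have hpair : Measurable fun x => (x, monotoneTransport α β x) := measurable_id.prodMk hm
    refine ⟨α.map fun x => (x, monotoneTransport α β x),
      Measure.isProbabilityMeasure_map hpair.aemeasurable, ?_, ?_, ?_⟩
    · rw [Measure.map_map measurable_fst hpair]
      exact Measure.map_id
    · rw [Measure.map_map measurable_snd hpair]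
      exact map_monotoneTransport α β
    · rw [integral_map hpair.aemeasurable (by fun_prop)]
  have hlb : ∫ x, |x - monotoneTransport α β x| ^ 2 ∂α ∈ lowerBounds
      {c : ℝ | ∃ π : Measure (ℝ × ℝ), IsProbabilityMeasure π ∧
        π.map Prod.fst = α ∧ π.map Prod.snd = β ∧ c = ∫ p, |p.1 - p.2| ^ 2 ∂π} := by
    rintro c ⟨π, hπ, h1, h2, rfl⟩
    exact integral_monotoneTransport_le hα2 hβ2 measurable_fst measurable_snd h1 h2
  exact (IsLeast.csInf_eq ⟨hmem, hlb⟩).symm
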